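/- arXiv:2503.07335 — 5 statements merged into one kernel-verified Lean document; each statement's English description precedes it below -/
import Mathlib

section
/- Let n be even, let k ≥ 1 with 2k ≤ n, and let 1 ≤ j₁ < j₂ < ⋯ < j_k ≤ n. Then P( p(j_h) > j_h for all h = 1,…,k ) = ∏_{h=1}^{k} (n − j_h − 2(k−h)) / (n − (2(k−h)+1)). -/
/-- The probability, for a uniformly random perfect matching (fixed-point-free
involution) `p` of `Fin n`, that the event `A p` holds. -/
noncomputable def matchProb (n : ℕ) (A : (Fin n → Fin n) → Prop) : ℝ :=
  (Nat.card {p : Fin n → Fin n // Function.Involutive p ∧ (∀ x, p x ≠ x) ∧ A p} : ℝ) /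
  (Nat.card {p : Fin n → Fin n // Function.Involutive p ∧ ∀ x, p x ≠ x} : ℝ)

open Finset in
def fibEquiv {α : Type} [DecidableEq α] (R : α → α → Prop) (a b : α) (hab : a ≠ b)
    (h1 : R a b) (h2 : R b a) :
    {p : {p : α → α // Function.Involutive p ∧ ∀ x, R x (p x)} // p.1 a = b} ≃
    {q : {x : α // x ≠ a ∧ x ≠ b} → {x : α // x ≠ a ∧ x ≠ b} //
      Function.Involutive q ∧ ∀ x, R x.1 (q x).1} where
  toFun p := ⟨fun x => ⟨p.1.1 x.1, by
      obtain ⟨⟨p, hi, hr⟩, hp⟩ := p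
      obtain ⟨x, hxa, hxb⟩ := x
      simp only at hp ⊢
      have hi' : ∀ x, p (p x) = x := hi
      refine ⟨fun h => hxb ?_, fun h => hxa ?_⟩
      · rw [← hi' x, h, hp]
      · rw [← hi' x, h, ← hp, hi']⟩, by
      refine ⟨fun x => Subtype.ext (p.1.2.1 x.1), fun x => p.1.2.2 x.1⟩⟩
  invFun q := ⟨⟨fun x => if h : x ≠ a ∧ x ≠ b then (q.1 ⟨x, h⟩).1 else if x = a then b else a, by
      obtain ⟨q, hi, hr⟩ := q
      constructor
      · intro x
        by_cases h : x ≠ a ∧ x ≠ b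
        · have h3 := (q ⟨x, h⟩).2
          have h4 := hi ⟨x, h⟩
          simp [h, h3, h4]
        · by_cases hx : x = a
          · subst hx; simp [hab.symm]
          · have : x = b := by tauto
            subst this; simp [hx]
      · intro x
        by_cases h : x ≠ a ∧ x ≠ b
        · simpa [h] using hr ⟨x, h⟩
        · by_cases hx : x = a
          · subst hx; simpa using h1
          · have : x = b := by tauto
            subst this; simpa [hx] using h2⟩, by simp⟩
  left_inv := by
    rintro ⟨⟨p, hi, hr⟩, hp⟩
    ext x
    simp only at hp ⊢
    by_cases h : x ≠ a ∧ x ≠ b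
    · simp [h]
    · by_cases hx : x = a
      · subst hx; simp [hp]
      · have : x = b := by tauto
        subst this; simp [← hp, hi a]
  right_inv := by
    rintro ⟨q, hi, hr⟩
    ext x
    simp [x.2]

noncomputable def cntR (α : Type) (R : α → α → Prop) : ℕ :=
  Nat.card {p : α → α // Function.Involutive p ∧ ∀ x, R x (p x)}

theorem cntR_rec {α : Type} [Fintype α] [DecidableEq α] (R : α → α → Prop) (a : α)
    (B : Finset α) (hB : ∀ b, b ∈ B ↔ R a b ∧ R b a) (ha : a ∉ B) (c : ℕ)
    (hc : ∀ b ∈ B, cntR {x : α // x ≠ a ∧ x ≠ b} (fun x y => R x.1 y.1) = c) :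
    cntR α R = B.card * c := by
  classical
  unfold cntR
  rw [← Nat.card_congr (Equiv.sigmaFiberEquiv
    (fun p : {p : α → α // Function.Involutive p ∧ ∀ x, R x (p x)} => p.1 a)), Nat.card_sigma]
  have : ∀ b, Nat.card {p : {p : α → α // Function.Involutive p ∧ ∀ x, R x (p x)} // p.1 a = b}
      = if b ∈ B then c else 0 := by
    intro b
    split_ifs with hb
    · have h := (hB b).1 hb
      rw [← hc b hb]
      exact Nat.card_congr (fibEquiv R a b (fun h => ha (h ▸ hb)) h.1 h.2)
    · rw [Nat.card_eq_zero]
      left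
      constructor
      rintro ⟨⟨p, hi, hr⟩, hp⟩
      apply hb
      rw [hB]
      simp only at hp
      have h1 := hr a
      have h2 := hr b
      rw [hp] at h1
      rw [← hp, hi a, hp] at h2
      exact ⟨h1, h2⟩
  simp only [this]
  simp

def MM : ℕ → ℕ
  | 0 => 1
  | 1 => 0
  | (n+2) => (n+1) * MM n

theorem MM_pos (n : ℕ) : 0 < MM (2 * n) := by
  induction n with
  | zero => simp [MM]
  | succ n ih => rw [show 2 * (n+1) = 2*n+2 by ring, MM]; positivity

theorem MM_prod (k n : ℕ) (h : 2 * k ≤ n) :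
    MM n = (∏ i ∈ Finset.range k, (n - (2 * i + 1))) * MM (n - 2 * k) := by
  induction k with
  | zero => simp
  | succ k ih =>
    rw [ih (by omega), Finset.prod_range_succ, mul_assoc]
    obtain ⟨m, rfl⟩ : ∃ m, n = m + 2 * k + 2 := ⟨n - 2 * k - 2, by omega⟩
    rw [show m + 2 * k + 2 - 2 * k = m + 2 by omega, MM,
      show m + 2 * k + 2 - (2 * k + 1) = m + 1 by omega,
      show m + 2 * k + 2 - 2 * (k + 1) = m by omega]

theorem card_pair {α : Type} [Fintype α] [DecidableEq α] {a b : α} (h : a ≠ b) :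
    Fintype.card {x : α // x ≠ a ∧ x ≠ b} = Fintype.card α - 2 := by
  rw [Fintype.card_subtype]
  have : (Finset.univ.filter fun x => x ≠ a ∧ x ≠ b) = (({a, b} : Finset α))ᶜ := by
    ext x; simp
  rw [this, Finset.card_compl, Finset.card_pair h]

theorem cnt_base (n : ℕ) : ∀ (α : Type) [Fintype α], Fintype.card α = n →
    cntR α (fun x y => x ≠ y) = MM n := by
  classical
  induction n using Nat.strong_induction_on with
  | _ n ih =>
  intro α _ hα
  rcases n with _ | n
  · have : IsEmpty α := Fintype.card_eq_zero_iff.1 hα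
    simp [MM, cntR, Function.Involutive]
  · obtain ⟨a⟩ : Nonempty α := Fintype.card_pos_iff.1 (by omega)
    have key := cntR_rec (fun x y : α => x ≠ y) a (Finset.univ.erase a)
      (by intro b; simp [eq_comm]) (by simp) (MM (n + 1 - 2)) (by
        intro b hb
        have hab : a ≠ b := by simpa [eq_comm] using hb
        rw [← ih (n+1-2) (by omega) {x : α // x ≠ a ∧ x ≠ b} (by rw [card_pair hab, hα])]
        congr 1
        ext x y
        simp [Subtype.ext_iff])
    rw [key]
    simp only [Finset.mem_univ, Finset.card_erase_of_mem, Finset.card_univ, hα]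
    rcases n with _ | n
    · simp [MM]
    · simp [MM]

theorem cnt_main (k : ℕ) : ∀ (α : Type) [Fintype α] [LinearOrder α] (J : Finset α),
    J.card = k → 2 * k ≤ Fintype.card α →
    cntR α (fun x y => x ≠ y ∧ (x ∈ J → x < y)) =
      (∏ x ∈ J, ((Finset.univ.filter (fun y => x < y)).card
        - 2 * (J.filter (fun y => x < y)).card)) * MM (Fintype.card α - 2 * k) := by
  induction k with
  | zero =>
    intro α _ _ J hJ _
    have : J = ∅ := Finset.card_eq_zero.1 hJ
    subst this
    simpa using cnt_base _ α rfl
  | succ k ih =>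
    intro α _ _ J hJ hc
    have hne : J.Nonempty := Finset.card_pos.1 (by omega)
    set a := J.max' hne with ha
    have haJ : a ∈ J := J.max'_mem hne
    have hmax : ∀ x ∈ J, x ≤ a := fun x hx => J.le_max' x hx
    clear_value a
    have key := cntR_rec (fun x y : α => x ≠ y ∧ (x ∈ J → x < y)) a
      (Finset.univ.filter (fun y => a < y))
      (by
        intro b
        simp only [Finset.mem_filter, Finset.mem_univ, true_and]
        constructor
        · intro h
          exact ⟨⟨h.ne, fun _ => h⟩, h.ne', fun hb => absurd (hmax b hb) (not_le.2 h)⟩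
        · intro h; exact h.1.2 haJ) (by simp)
      ((∏ x ∈ J.erase a, ((Finset.univ.filter (fun y => x < y)).card
        - 2 * (J.filter (fun y => x < y)).card)) * MM (Fintype.card α - 2 * (k+1))) (by
        intro b hb
        have hab : a < b := by simpa using hb
        have hbJ : b ∉ J := fun hb => absurd (hmax b hb) (not_le.2 hab)
        have hmap : (J.subtype (fun x => x ≠ a ∧ x ≠ b)).map (Function.Embedding.subtype _)
            = J.erase a := by
          rw [Finset.subtype_map]
          ext x
          simp only [Finset.mem_filter, Finset.mem_erase]
          constructor
          · tauto
          · rintro ⟨h1, h2⟩; exact ⟨h2, h1, fun h => hbJ (h ▸ h2)⟩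
        have hcard : (J.subtype (fun x => x ≠ a ∧ x ≠ b)).card = k := by
          rw [← Finset.card_map (Function.Embedding.subtype _), hmap,
            Finset.card_erase_of_mem haJ, hJ]; rfl
        have h := ih {x : α // x ≠ a ∧ x ≠ b} (J.subtype (fun x => x ≠ a ∧ x ≠ b)) hcard
          (by rw [card_pair hab.ne]; omega)
        rw [card_pair hab.ne, show Fintype.card α - 2 - 2 * k = Fintype.card α - 2 * (k+1) by omega]
          at h
        rw [← hmap, Finset.prod_map]
        convert h using 2
        · ext x y
          simp [Subtype.ext_iff]
        · apply Finset.prod_congr rfl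
          intro x hx
          have hxJ : x.1 ∈ J := by simpa using hx
          have hxa : x.1 < a := lt_of_le_of_ne (hmax _ hxJ) x.2.1
          have e1 : (Finset.univ.filter (fun y => x < y)).card
              = (Finset.univ.filter (fun y => x.1 < y)).card - 2 := by
            rw [← Finset.card_map (Function.Embedding.subtype _)]
            have : (Finset.univ.filter (fun y => x < y)).map (Function.Embedding.subtype _)
              = (Finset.univ.filter (fun y => x.1 < y)) \ {a, b} := by
              ext y
              simp [← Subtype.coe_lt_coe]
            rw [this, Finset.card_sdiff_of_subset, Finset.card_pair hab.ne]
            intro y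
            simp only [Finset.mem_insert, Finset.mem_singleton, Finset.mem_filter,
              Finset.mem_univ, true_and]
            rintro (rfl | rfl)
            · exact hxa
            · exact hxa.trans hab
          have e2 : ((J.subtype (fun x => x ≠ a ∧ x ≠ b)).filter (fun y => x < y)).card
              = (J.filter (fun y => x.1 < y)).card - 1 := by
            rw [← Finset.card_map (Function.Embedding.subtype _)]
            have : ((J.subtype (fun x => x ≠ a ∧ x ≠ b)).filter (fun y => x < y)).map
              (Function.Embedding.subtype _)
              = (J.filter (fun y => x.1 < y)).erase a := by
              ext y
              simp only [Finset.mem_map, Finset.mem_filter, Finset.mem_subtype,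
                Function.Embedding.subtype_apply, Finset.mem_erase]
              constructor
              · rintro ⟨z, ⟨h1, h2⟩, rfl⟩
                exact ⟨z.2.1, h1, h2⟩
              · rintro ⟨h1, h2, h3⟩
                exact ⟨⟨y, h1, fun h => hbJ (h ▸ h2)⟩, ⟨h2, h3⟩, rfl⟩
            rw [this, Finset.card_erase_of_mem]
            simp [haJ, hxa]
          have e3 : 0 < (J.filter (fun y => x.1 < y)).card :=
            Finset.card_pos.2 ⟨a, by simp [haJ, hxa]⟩
          rw [e1, e2]
          change (Finset.univ.filter (fun y => x.1 < y)).card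
            - 2 * (J.filter (fun y => x.1 < y)).card = _
          omega)
    rw [key, ← Finset.mul_prod_erase J _ haJ]
    have : J.filter (fun y => a < y) = ∅ := by
      rw [Finset.filter_eq_empty_iff]
      intro x hx
      exact not_lt.2 (hmax x hx)
    rw [this]
    simp [mul_assoc]

/-- For `1 ≤ j₁ < ⋯ < j_k ≤ n` (encoded 0-indexed as a strictly monotone
`j : Fin k → Fin n`, so the 1-based value of `j h` is `(j h : ℕ) + 1`, and 1-based
`h` is `(h : ℕ) + 1`),
`P(p(j_h) > j_h ∀ h) = ∏_{h=1}^{k} (n − j_h − 2(k−h)) / (n − (2(k−h)+1))`. -/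
theorem stmt4 (n k : ℕ) (hn : Even n) (hk : 1 ≤ k) (h2k : 2 * k ≤ n)
    (j : Fin k → Fin n) (hj : StrictMono j) :
    matchProb n (fun p => ∀ h : Fin k, j h < p (j h)) =
      ∏ h : Fin k,
        ((n - ((j h : ℕ) + 1) - 2 * (k - 1 - (h : ℕ)) : ℕ) : ℝ) /
          ((n - (2 * (k - 1 - (h : ℕ)) + 1) : ℕ) : ℝ) := by
  have hcM : Nat.card {p : Fin n → Fin n // Function.Involutive p ∧ ∀ x, p x ≠ x} = MM n := by
    rw [← cnt_base n (Fin n) (by simp)]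
    unfold cntR
    simp only [ne_comm]
  have hinj := hj.injective
  have hcJ : Nat.card {p : Fin n → Fin n // Function.Involutive p ∧ (∀ x, p x ≠ x) ∧
      ∀ h : Fin k, j h < p (j h)} =
      (∏ h : Fin k, (n - ((j h : ℕ) + 1) - 2 * (k - 1 - (h : ℕ)))) * MM (n - 2 * k) := by
    have h := cnt_main k (Fin n) (Finset.univ.map ⟨j, hinj⟩) (by simp) (by simpa using h2k)
    rw [Finset.prod_map] at h
    have e : ∀ h : Fin k, (Finset.univ.filter (fun y => j h < y)).card
        - 2 * ((Finset.univ.map ⟨j, hinj⟩).filter (fun y => j h < y)).card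
        = n - ((j h : ℕ) + 1) - 2 * (k - 1 - (h : ℕ)) := by
      intro h
      have e1 : (Finset.univ.filter (fun y => j h < y)).card = n - ((j h : ℕ) + 1) := by
        rw [show (Finset.univ.filter (fun y => j h < y)) = Finset.Ioi (j h) by ext; simp,
          Fin.card_Ioi]
        omega
      have e2 : ((Finset.univ.map ⟨j, hinj⟩).filter (fun y => j h < y)).card
          = k - 1 - (h : ℕ) := by
        rw [Finset.filter_map, Finset.card_map, ← Fin.card_Ioi]
        congr 1
        ext x
        simp [hj.lt_iff_lt]
      rw [e1, e2]
    simp only [Function.Embedding.coeFn_mk, e, Fintype.card_fin] at h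
    rw [← h]
    unfold cntR
    apply Nat.card_congr
    apply Equiv.subtypeEquivRight
    intro p
    apply and_congr_right
    intro _
    simp only [Finset.mem_map, Finset.mem_univ, true_and, Function.Embedding.coeFn_mk]
    constructor
    · rintro ⟨h1, h2⟩ x
      refine ⟨(h1 x).symm, ?_⟩
      rintro ⟨i, rfl⟩
      exact h2 i
    · intro h
      exact ⟨fun x => (h x).1.symm, fun i => (h _).2 ⟨i, rfl⟩⟩
  unfold matchProb
  rw [hcM, hcJ, MM_prod k n h2k, Finset.prod_div_distrib]
  have hM : (MM (n - 2 * k) : ℝ) ≠ 0 := by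
    obtain ⟨m, rfl⟩ := hn
    have := MM_pos (m - k)
    rw [show m + m - 2 * k = 2 * (m - k) by omega]
    exact_mod_cast this.ne'
  push_cast
  rw [mul_div_mul_right _ _ hM]
  congr 1
  rw [← Finset.prod_range_reflect, Finset.prod_range]
end

section
/- Let n be even and for j ∈ {1,…,n} set Y_j = 1 if p(j) > j and Y_j = 0 otherwise. Then both families {Y_j} and {1−Y_j} are negatively correlated: for every subset J ⊆ {1,…,n}, P( p(j) > j for all j ∈ J ) ≤ ∏_{j∈J} (n−j)/(n−1), and P( p(j) < j for all j ∈ J ) ≤ ∏_{j∈J} (j−1)/(n−1); here (n−j)/(n−1) = P(p(j) > j) and (j−1)/(n−1) = P(p(j) < j). -/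
open Classical in
/-- Fixed-point-free involutions going up on `K`. -/
noncomputable def upSet (n : ℕ) (K : Finset (Fin n)) : Finset (Fin n → Fin n) :=
  Finset.univ.filter (fun p => Function.Involutive p ∧ (∀ x, p x ≠ x) ∧ ∀ i ∈ K, i < p i)

lemma mem_upSet {n : ℕ} {K : Finset (Fin n)} {p : Fin n → Fin n} :
    p ∈ upSet n K ↔ Function.Involutive p ∧ (∀ x, p x ≠ x) ∧ ∀ i ∈ K, i < p i := by
  simp [upSet]

/-- Available partners. -/
def avail {n : ℕ} (K : Finset (Fin n)) (j : Fin n) (p : Fin n → Fin n) : Finset (Fin n) :=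
  Finset.univ.filter (fun b => b ∉ K ∧ p b ∉ K ∧ b ≠ j)

lemma mem_avail {n : ℕ} {K : Finset (Fin n)} {j : Fin n} {p : Fin n → Fin n} {b : Fin n} :
    b ∈ avail K j p ↔ b ∉ K ∧ p b ∉ K ∧ b ≠ j := by
  simp [avail]

lemma card_KpK {n : ℕ} {K : Finset (Fin n)} {p : Fin n → Fin n} (hp : p ∈ upSet n K) :
    (K ∪ K.image p).card = 2 * K.card := by
  obtain ⟨h1, h2, h3⟩ := mem_upSet.1 hp
  rw [Finset.card_union_of_disjoint, Finset.card_image_of_injective _ h1.injective]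
  · ring
  · rw [Finset.disjoint_left]
    intro a ha hb
    obtain ⟨i, hi, rfl⟩ := Finset.mem_image.1 hb
    have := h3 _ ha
    rw [h1 i] at this
    exact absurd (h3 i hi) this.not_gt

lemma notMem_KpK {n : ℕ} {K : Finset (Fin n)} {j : Fin n} (hj : ∀ i ∈ K, j < i)
    {p : Fin n → Fin n} (hp : p ∈ upSet n K) : ∀ b ∈ K ∪ K.image p, j < b := by
  obtain ⟨h1, h2, h3⟩ := mem_upSet.1 hp
  intro b hb
  rcases Finset.mem_union.1 hb with hb | hb
  · exact hj b hb
  · obtain ⟨i, hi, rfl⟩ := Finset.mem_image.1 hb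
    exact (hj i hi).trans (h3 i hi)

lemma mem_KpK {n : ℕ} {K : Finset (Fin n)} {p : Fin n → Fin n} (h1 : Function.Involutive p)
    (b : Fin n) : b ∈ K ∪ K.image p ↔ b ∈ K ∨ p b ∈ K := by
  rw [Finset.mem_union, Finset.mem_image]
  refine or_congr Iff.rfl ⟨?_, fun h => ⟨p b, h, h1 b⟩⟩
  rintro ⟨i, hi, rfl⟩
  rwa [h1 i]

lemma card_avail {n : ℕ} {K : Finset (Fin n)} {j : Fin n} (hj : ∀ i ∈ K, j < i)
    {p : Fin n → Fin n} (hp : p ∈ upSet n K) :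
    (avail K j p).card + 2 * K.card + 1 = n := by
  have h1 := (mem_upSet.1 hp).1
  have e : avail K j p = (insert j (K ∪ K.image p))ᶜ := by
    ext b
    rw [mem_avail, Finset.mem_compl, Finset.mem_insert, mem_KpK h1]
    tauto
  have hn : j ∉ K ∪ K.image p := fun h => lt_irrefl _ (notMem_KpK hj hp _ h)
  have := Finset.card_add_card_compl (insert j (K ∪ K.image p))
  rw [Finset.card_insert_of_notMem hn, card_KpK hp, Fintype.card_fin] at this
  rw [e]; omega

lemma card_avail_gt {n : ℕ} {K : Finset (Fin n)} {j : Fin n} (hj : ∀ i ∈ K, j < i)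
    {p : Fin n → Fin n} (hp : p ∈ upSet n K) :
    ((avail K j p).filter (fun b => j < b)).card + 2 * K.card + 1 + j = n := by
  have h1 := (mem_upSet.1 hp).1
  have e : (avail K j p).filter (fun b => j < b) = Finset.Ioi j \ (K ∪ K.image p) := by
    ext b
    rw [Finset.mem_filter, mem_avail, Finset.mem_sdiff, mem_KpK h1, Finset.mem_Ioi]
    constructor
    · tauto
    · rintro ⟨h, h'⟩
      have := h.ne'
      tauto
  have hs : K ∪ K.image p ⊆ Finset.Ioi j := fun b hb => Finset.mem_Ioi.2 (notMem_KpK hj hp b hb)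
  have h5 := Finset.card_sdiff_add_card_eq_card hs
  rw [card_KpK hp, Fin.card_Ioi] at h5
  have := j.2
  rw [e]; omega

/-- Switching map. -/
def switch {n : ℕ} (j : Fin n) (x : (_ : Fin n → Fin n) × Fin n) : (_ : Fin n → Fin n) × Fin n :=
  ⟨fun y => Equiv.swap (x.1 j) x.2 (x.1 (Equiv.swap (x.1 j) x.2 y)), x.1 j⟩

lemma switch_spec {n : ℕ} {K : Finset (Fin n)} {j : Fin n} (hj : ∀ i ∈ K, j < i)
    {p : Fin n → Fin n} {b : Fin n} (hp : p ∈ upSet n K) (hb : b ∈ avail K j p) :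
    (switch j ⟨p, b⟩).1 ∈ upSet n K ∧ (switch j ⟨p, b⟩).2 ∈ avail K j (switch j ⟨p, b⟩).1 ∧
    (switch j ⟨p, b⟩).1 j = b ∧ switch j (switch j ⟨p, b⟩) = ⟨p, b⟩ := by
  obtain ⟨h1, h2, h3⟩ := mem_upSet.1 hp
  obtain ⟨b1, b2, b3⟩ := mem_avail.1 hb
  have hjK : j ∉ K := fun h => lt_irrefl _ (hj j h)
  have hpj : p j ∉ K := fun h => by
    have := h3 _ h
    rw [h1 j] at this
    exact absurd (hj _ h) this.not_gt
  have hqj : Equiv.swap (p j) b (p (Equiv.swap (p j) b j)) = b := by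
    rw [Equiv.swap_apply_of_ne_of_ne (h2 j).symm b3.symm, Equiv.swap_apply_left]
  refine ⟨mem_upSet.2 ⟨?_, ?_, ?_⟩, mem_avail.2 ⟨hpj, ?_, h2 j⟩, hqj, ?_⟩
  · intro y
    simp [switch, h1 _]
  · intro y h
    simp only [switch] at h
    apply h2 (Equiv.swap (p j) b y)
    apply (Equiv.swap (p j) b).injective
    rw [h, Equiv.swap_apply_self]
  · intro i hi
    have e1 : i ≠ p j := fun h => hpj (h ▸ hi)
    have e2 : i ≠ b := fun h => b1 (h ▸ hi)
    have e3 : p i ≠ p j := fun h => hjK (h1.injective h ▸ hi)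
    have e4 : p i ≠ b := fun h => b2 (by rw [← h, h1 i]; exact hi)
    simp only [switch]
    rw [Equiv.swap_apply_of_ne_of_ne e1 e2, Equiv.swap_apply_of_ne_of_ne e3 e4]
    exact h3 i hi
  · simp only [switch]
    rw [Equiv.swap_apply_left, Equiv.swap_apply_of_ne_of_ne (fun h => b3 (h1.injective h)) (h2 b)]
    exact b2
  · have : switch j (switch j ⟨p, b⟩) =
        ⟨fun y => Equiv.swap b (p j) (Equiv.swap (p j) b (p (Equiv.swap (p j) b
          (Equiv.swap b (p j) y)))), b⟩ := by
      simp only [switch]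
      rw [hqj]
    rw [this]
    simp [Equiv.swap_comm b (p j)]

lemma upSet_insert {n : ℕ} (K : Finset (Fin n)) (j : Fin n) :
    upSet n (insert j K) = (upSet n K).filter (fun p => j < p j) := by
  ext p
  simp only [Finset.mem_filter, mem_upSet, Finset.forall_mem_insert]
  tauto

lemma key {n : ℕ} {K : Finset (Fin n)} {j : Fin n} (hj : ∀ i ∈ K, j < i) :
    ((upSet n (insert j K)).card : ℝ) * ((n : ℝ) - 1 - 2 * K.card) =
      (upSet n K).card * ((n : ℝ) - 1 - j - 2 * K.card) := by
  have hL : ((upSet n (insert j K)).sigma (fun p => avail K j p)).card =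
      ((upSet n K).sigma (fun p => (avail K j p).filter (fun b => j < b))).card := by
    rw [upSet_insert]
    apply Finset.card_nbij' (switch j) (switch j)
    · rintro ⟨p, b⟩ h
      simp only [Finset.coe_sigma, Set.mem_sigma_iff, Finset.mem_coe, Finset.mem_filter] at h ⊢
      obtain ⟨s1, s2, s3, s4⟩ := switch_spec hj h.1.1 h.2
      exact ⟨s1, s2, h.1.2⟩
    · rintro ⟨p, b⟩ h
      simp only [Finset.coe_sigma, Set.mem_sigma_iff, Finset.mem_coe, Finset.mem_filter] at h ⊢
      obtain ⟨s1, s2, s3, s4⟩ := switch_spec hj h.1 h.2.1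
      exact ⟨⟨s1, by rw [s3]; exact h.2.2⟩, s2⟩
    · rintro ⟨p, b⟩ h
      simp only [Finset.coe_sigma, Set.mem_sigma_iff, Finset.mem_coe, Finset.mem_filter] at h
      exact (switch_spec hj h.1.1 h.2).2.2.2
    · rintro ⟨p, b⟩ h
      simp only [Finset.coe_sigma, Set.mem_sigma_iff, Finset.mem_coe, Finset.mem_filter] at h
      exact (switch_spec hj h.1 h.2.1).2.2.2
  rw [Finset.card_sigma, Finset.card_sigma] at hL
  have hR : ((∑ p ∈ upSet n (insert j K), (avail K j p).card : ℕ) : ℝ) =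
      (∑ p ∈ upSet n K, ((avail K j p).filter (fun b => j < b)).card : ℕ) := by rw [hL]
  rw [Nat.cast_sum, Nat.cast_sum] at hR
  rw [Finset.sum_congr rfl (g := fun _ => (n : ℝ) - 1 - 2 * K.card),
    Finset.sum_congr (s₁ := upSet n K) rfl (g := fun _ => (n : ℝ) - 1 - j - 2 * K.card)] at hR
  · rw [Finset.sum_const, Finset.sum_const, nsmul_eq_mul, nsmul_eq_mul] at hR
    exact hR
  · intro p hp
    have := card_avail_gt hj hp
    have : (((avail K j p).filter (fun b => j < b)).card : ℝ) + 2 * K.card + 1 + (j : ℕ) = n := by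
      exact_mod_cast this
    linarith
  · intro p hp
    rw [upSet_insert] at hp
    have := card_avail hj (Finset.mem_filter.1 hp).1
    have : ((avail K j p).card : ℝ) + 2 * K.card + 1 = n := by
      exact_mod_cast this
    linarith

lemma total_pos {n : ℕ} (hn : Even n) : 0 < (upSet n ∅).card := by
  obtain ⟨m, hm⟩ := hn
  rw [Finset.card_pos]
  refine ⟨fun x => if h : (x : ℕ) % 2 = 0 then ⟨x + 1, by omega⟩ else ⟨x - 1, by omega⟩, ?_⟩
  refine mem_upSet.2 ⟨?_, ?_, by simp⟩
  · intro x
    ext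
    by_cases h : (x : ℕ) % 2 = 0
    · have : ¬ ((x : ℕ) + 1) % 2 = 0 := by omega
      simp [h, this]
    · have : ((x : ℕ) - 1) % 2 = 0 := by omega
      simp [h, this]
      omega
  · intro x h
    rw [Fin.ext_iff] at h
    by_cases h' : (x : ℕ) % 2 = 0
    · simp [h'] at h
    · simp [h'] at h
      omega

lemma upSet_bound {n : ℕ} (hn : Even n) (hn0 : 0 < n) (J : Finset (Fin n)) :
    ((upSet n J).card : ℝ) / (upSet n ∅).card ≤
      ∏ j ∈ J, ((n : ℝ) - (j : ℕ) - 1) / ((n : ℝ) - 1) := by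
  have hT : (0 : ℝ) < (upSet n ∅).card := by exact_mod_cast total_pos hn
  have hn2 : (2 : ℝ) ≤ n := by
    obtain ⟨m, hm⟩ := hn
    exact_mod_cast (by omega : 2 ≤ n)
  have hnn : ∀ j : Fin n, 0 ≤ ((n : ℝ) - (j : ℕ) - 1) / ((n : ℝ) - 1) := fun j => by
    have : ((j : ℕ) : ℝ) + 1 ≤ n := by exact_mod_cast j.2
    exact div_nonneg (by linarith) (by linarith)
  induction J using Finset.induction_on_min with
  | empty => simp [hT.ne']
  | insert j K hj ih =>
    have hjK : j ∉ K := fun h => lt_irrefl _ (hj j h)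
    rw [Finset.prod_insert hjK]
    rcases (upSet n K).eq_empty_or_nonempty with h0 | ⟨p, hp⟩
    · rw [upSet_insert, h0]
      simpa using mul_nonneg (hnn j) (Finset.prod_nonneg fun i _ => hnn i)
    · have hk := key hj
      have c1 := card_avail_gt hj hp
      have c2 : (0 : ℝ) ≤ (n : ℝ) - 1 - j - 2 * K.card := by
        have : (2 * K.card + 1 + j : ℝ) ≤ n := by exact_mod_cast (by omega)
        linarith
      have c3 : (0 : ℝ) < (n : ℝ) - 1 - 2 * K.card := by
        have : (2 * K.card + 2 : ℝ) ≤ n := by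
          obtain ⟨m, hm⟩ := hn
          exact_mod_cast (by omega : 2 * K.card + 2 ≤ n)
        linarith
      have e : ((upSet n (insert j K)).card : ℝ) / (upSet n ∅).card =
          ((n : ℝ) - 1 - j - 2 * K.card) / ((n : ℝ) - 1 - 2 * K.card) *
          ((upSet n K).card / (upSet n ∅).card) := by
        field_simp
        linarith
      rw [e]
      refine mul_le_mul ?_ ih (by positivity) (hnn j)
      rw [div_le_div_iff₀ c3 (by linarith)]
      have : (0 : ℝ) ≤ (j : ℕ) * K.card := by positivity
      nlinarith

lemma upSet_single {n : ℕ} (hn : Even n) (hn0 : 0 < n) (j : Fin n) :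
    ((upSet n {j}).card : ℝ) / (upSet n ∅).card = ((n : ℝ) - (j : ℕ) - 1) / ((n : ℝ) - 1) := by
  have hT : (0 : ℝ) < (upSet n ∅).card := by exact_mod_cast total_pos hn
  have hn2 : (2 : ℝ) ≤ n := by
    obtain ⟨m, hm⟩ := hn
    exact_mod_cast (by omega : 2 ≤ n)
  have hk := key (n := n) (K := ∅) (j := j) (by simp)
  simp only [insert_empty_eq, Finset.card_empty] at hk
  rw [div_eq_div_iff hT.ne' (by linarith)]
  push_cast at hk
  linarith

lemma card_sub {n : ℕ} (K : Finset (Fin n)) :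
    Nat.card {p : Fin n → Fin n // Function.Involutive p ∧ (∀ x, p x ≠ x) ∧ ∀ j ∈ K, j < p j} =
      (upSet n K).card := by
  rw [← Nat.card_eq_finsetCard]
  exact Nat.card_congr (Equiv.subtypeEquivRight fun p => by simp [mem_upSet])

lemma matchProb_up {n : ℕ} (K : Finset (Fin n)) :
    matchProb n (fun p => ∀ j ∈ K, j < p j) = ((upSet n K).card : ℝ) / (upSet n ∅).card := by
  rw [matchProb, card_sub, ← card_sub ∅]
  simp

/-- Conjugation by reversal. -/
def revEquiv (n : ℕ) : (Fin n → Fin n) ≃ (Fin n → Fin n) where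
  toFun p := fun x => (p x.rev).rev
  invFun p := fun x => (p x.rev).rev
  left_inv p := by ext; simp
  right_inv p := by ext; simp

lemma matchProb_down {n : ℕ} (K : Finset (Fin n)) :
    matchProb n (fun p => ∀ j ∈ K, p j < j) =
      matchProb n (fun p => ∀ j ∈ K.map Fin.revPerm.toEmbedding, j < p j) := by
  unfold matchProb
  congr 2
  refine Nat.card_congr (Equiv.subtypeEquiv (revEquiv n) fun p => ?_)
  refine and_congr ?_ (and_congr ?_ ?_)
  · constructor
    · intro h x
      simp [revEquiv, h _]
    · intro h x
      have := h x.rev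
      simpa [revEquiv] using this
  · constructor
    · intro h x h'
      exact h x.rev (Fin.rev_injective (by simpa [revEquiv] using h'))
    · intro h x h'
      exact h x.rev (by simp [revEquiv, h'])
  · simp only [revEquiv, Finset.mem_map_equiv, Equiv.coe_fn_mk]
    constructor
    · intro h j hj
      have := h j.rev (by simpa using hj)
      rw [← Fin.rev_lt_rev]
      simpa using this
    · intro h j hj
      have := h j.rev (by simpa using hj)
      rw [← Fin.rev_lt_rev]
      simpa using this

/-- Negative correlation for a uniformly random perfect matching of `{1,…,n}`
(vertices 0-indexed: the 1-based value of `j` is `(j : ℕ) + 1`, so 1-based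
`(n−j)/(n−1)` is `(n − (j:ℕ) − 1)/(n−1)` and 1-based `(j−1)/(n−1)` is `(j:ℕ)/(n−1)`):
for every `J ⊆ {1,…,n}`, `P(p(j) > j ∀ j ∈ J) ≤ ∏_{j∈J} (n−j)/(n−1)` and
`P(p(j) < j ∀ j ∈ J) ≤ ∏_{j∈J} (j−1)/(n−1)`; moreover `(n−j)/(n−1) = P(p(j) > j)`
and `(j−1)/(n−1) = P(p(j) < j)`. -/
theorem stmt5 (n : ℕ) (hn : Even n) (hn0 : 0 < n) (J : Finset (Fin n)) :
    matchProb n (fun p => ∀ j ∈ J, j < p j) ≤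
        ∏ j ∈ J, ((n : ℝ) - (j : ℕ) - 1) / ((n : ℝ) - 1) ∧
    matchProb n (fun p => ∀ j ∈ J, p j < j) ≤
        ∏ j ∈ J, ((j : ℕ) : ℝ) / ((n : ℝ) - 1) ∧
    (∀ j : Fin n, matchProb n (fun p => j < p j) =
        ((n : ℝ) - (j : ℕ) - 1) / ((n : ℝ) - 1)) ∧
    (∀ j : Fin n, matchProb n (fun p => p j < j) =
        ((j : ℕ) : ℝ) / ((n : ℝ) - 1)) := by
  have hd : ∀ j : Fin n, ((n : ℝ) - ((j.rev : Fin n) : ℕ) - 1) = ((j : ℕ) : ℝ) := fun j => by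
    rw [Fin.val_rev, Nat.cast_sub (by omega)]
    push_cast
    ring
  refine ⟨?_, ?_, fun j => ?_, fun j => ?_⟩
  · rw [matchProb_up]
    exact upSet_bound hn hn0 J
  · rw [matchProb_down, matchProb_up]
    refine (upSet_bound hn hn0 _).trans_eq ?_
    rw [Finset.prod_map]
    refine Finset.prod_congr rfl fun j _ => ?_
    rw [← hd j]
    rfl
  · rw [← upSet_single hn hn0 j, ← matchProb_up]
    simp
  · have h := matchProb_down ({j} : Finset (Fin n))
    rw [matchProb_up, Finset.map_singleton] at h
    have h2 := upSet_single hn hn0 j.rev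
    rw [hd j] at h2
    rw [← h2]
    refine Eq.trans ?_ h
    simp
end

section
/- Let i₁ = i₁(n) = n − ⌊n / log log n⌋. Then, with probability tending to 1 as n → ∞ through even integers, there exist integers a, b with i₁ < a < b ≤ n such that p(a) = b, b − a is odd, and p(k) ∉ {a, a+1, …, b} for every k with a < k < b. (Equivalently: some sequence of consecutive vertices in {i₁+1,…,n} induces an even cycle in the multigraph obtained as the union of the Hamilton cycle (1 2 ⋯ n) and the perfect matching encoded by p.) -/
/-- `i₁ = i₁(n) = n − ⌊n / log log n⌋`. -/
noncomputable def endPhase (n : ℕ) : ℕ := n - ⌊(n : ℝ) / Real.log (Real.log (n : ℝ))⌋₊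

open Finset Classical in
noncomputable def Om (n : ℕ) : Finset (Fin n → Fin n) :=
  univ.filter (fun p => Function.Involutive p ∧ ∀ x, p x ≠ x)

lemma mem_Om {n : ℕ} {p : Fin n → Fin n} :
    p ∈ Om n ↔ Function.Involutive p ∧ ∀ x, p x ≠ x := by
  simp [Om]

lemma conj_mem {n : ℕ} {p : Fin n → Fin n} (hp : p ∈ Om n) (x y : Fin n) :
    (fun z => Equiv.swap x y (p (Equiv.swap x y z))) ∈ Om n := by
  rw [mem_Om] at *
  refine ⟨fun z => ?_, fun z h => ?_⟩
  · simp [hp.1 _]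
  · apply hp.2 (Equiv.swap x y z)
    apply (Equiv.swap x y).injective
    simpa using h

open Finset Classical in
noncomputable def N1 (n : ℕ) (a b : Fin n) : Finset (Fin n → Fin n) :=
  (Om n).filter (fun p => p a = b)

open Finset Classical in
noncomputable def N2 (n : ℕ) (a b c d : Fin n) : Finset (Fin n → Fin n) :=
  (N1 n a b).filter (fun p => p c = d)

lemma N1_le {n : ℕ} {a b b' : Fin n} (h : b ≠ a) (h' : b' ≠ a) :
    (N1 n a b).card ≤ (N1 n a b').card := by
  classical
  apply Finset.card_le_card_of_injOn
    (fun p => fun z => Equiv.swap b b' (p (Equiv.swap b b' z)))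
  · intro p hp
    simp only [N1, Finset.coe_filter, Set.mem_ofPred_eq] at hp ⊢
    refine ⟨conj_mem hp.1 _ _, ?_⟩
    rw [Equiv.swap_apply_of_ne_of_ne h.symm h'.symm, hp.2, Equiv.swap_apply_left]
  · intro p _ q _ hpq
    funext z
    have := congrFun hpq (Equiv.swap b b' z)
    simpa using this

lemma N2_le {n : ℕ} {a b c d d' : Fin n} (hca : c ≠ a) (hcb : c ≠ b)
    (ha : d ≠ a) (hb : d ≠ b) (hc : d ≠ c)
    (ha' : d' ≠ a) (hb' : d' ≠ b) (hc' : d' ≠ c) :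
    (N2 n a b c d).card ≤ (N2 n a b c d').card := by
  classical
  apply Finset.card_le_card_of_injOn
    (fun p => fun z => Equiv.swap d d' (p (Equiv.swap d d' z)))
  · intro p hp
    simp only [N2, N1, Finset.coe_filter, Set.mem_ofPred_eq, Finset.mem_filter] at hp ⊢
    refine ⟨⟨conj_mem hp.1.1 _ _, ?_⟩, ?_⟩
    · rw [Equiv.swap_apply_of_ne_of_ne ha.symm ha'.symm, hp.1.2,
        Equiv.swap_apply_of_ne_of_ne hb.symm hb'.symm]
    · rw [Equiv.swap_apply_of_ne_of_ne hc.symm hc'.symm, hp.2, Equiv.swap_apply_left]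
  · intro p _ q _ hpq
    funext z
    have := congrFun hpq (Equiv.swap d d' z)
    simpa using this

lemma card_N1 {n : ℕ} {a b : Fin n} (h : b ≠ a) :
    (Om n).card = (n - 1) * (N1 n a b).card := by
  classical
  have h1 : ∀ p ∈ Om n, p a ∈ Finset.univ.erase a := by
    intro p hp
    simp [(mem_Om.1 hp).2 a]
  rw [Finset.card_eq_sum_card_fiberwise h1]
  have : ∀ b' ∈ Finset.univ.erase a, ((Om n).filter (fun p => p a = b')).card
      = (N1 n a b).card := by
    intro b' hb'
    have hb' : b' ≠ a := by simpa using hb'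
    exact le_antisymm (N1_le hb' h) (N1_le h hb')
  rw [Finset.sum_congr rfl this, Finset.sum_const, Finset.card_erase_of_mem (Finset.mem_univ _)]
  simp

lemma card_N2 {n : ℕ} {a b c d : Fin n} (hba : b ≠ a) (hca : c ≠ a) (hcb : c ≠ b)
    (ha : d ≠ a) (hb : d ≠ b) (hc : d ≠ c) :
    (N1 n a b).card = (n - 3) * (N2 n a b c d).card := by
  classical
  have h1 : ∀ p ∈ N1 n a b, p c ∈ Finset.univ \ {a, b, c} := by
    intro p hp
    simp only [N1, Finset.mem_filter, mem_Om] at hp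
    obtain ⟨⟨hi, hf⟩, hab⟩ := hp
    have e1 : p c ≠ a := fun e => hcb (by rw [← hab, ← e, hi c])
    have e2 : p c ≠ b := fun e => hca (hi.injective (e.trans hab.symm))
    simp [e1, e2, hf c]
  rw [Finset.card_eq_sum_card_fiberwise h1]
  have : ∀ d' ∈ Finset.univ \ {a, b, c}, ((N1 n a b).filter (fun p => p c = d')).card
      = (N2 n a b c d).card := by
    intro d' hd'
    simp only [Finset.mem_sdiff, Finset.mem_univ, true_and, Finset.mem_insert,
      Finset.mem_singleton, not_or] at hd'
    obtain ⟨x, y, z⟩ := hd'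
    exact le_antisymm (N2_le hca hcb x y z ha hb hc) (N2_le hca hcb ha hb hc x y z)
  rw [Finset.sum_congr rfl this, Finset.sum_const, Finset.card_sdiff_of_subset (Finset.subset_univ _),
    Finset.card_eq_three.2 ⟨a, b, c, hba.symm, hca.symm, hcb.symm, rfl⟩]
  simp

lemma Om_pos (m : ℕ) : 0 < (Om (2 * m)).card := by
  apply Finset.card_pos.2
  refine ⟨Fin.rev, mem_Om.2 ⟨Fin.rev_involutive, fun x h => ?_⟩⟩
  have := congrArg Fin.val h
  simp [Fin.val_rev] at this
  omega

/-- second moment -/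
lemma second_moment {n : ℕ} (hn : 4 ≤ n) (S : Finset (Fin n × Fin n))
    (hS : ∀ x ∈ S, x.1 < x.2) (hpos : 0 < S.card) (Z : Finset (Fin n → Fin n))
    (hZ : Z ⊆ Om n) (hZS : ∀ p ∈ Z, ∀ x ∈ S, p x.1 ≠ x.2) :
    (Z.card : ℝ) ≤ (Om n).card * (((n : ℝ) - 1) / S.card + 2 / ((n : ℝ) - 3)) := by
  classical
  set F : ℝ := ((Om n).card : ℝ) with hF
  set M : ℝ := (S.card : ℝ) with hM
  have hM0 : 0 < M := by rw [hM]; exact_mod_cast hpos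
  have hn' : (4 : ℝ) ≤ n := by exact_mod_cast hn
  have hn1 : (0 : ℝ) < n - 1 := by linarith
  have hn3 : (0 : ℝ) < n - 3 := by linarith
  let I : (Fin n → Fin n) → (Fin n × Fin n) → ℝ := fun p x => if p x.1 = x.2 then 1 else 0
  let X : (Fin n → Fin n) → ℝ := fun p => ∑ x ∈ S, I p x
  have c1 : ∀ x ∈ S, ∑ p ∈ Om n, I p x = F / (n - 1) := by
    intro x hx
    have h := card_N1 (hS x hx).ne'
    have h' : F = (n - 1) * ((N1 n x.1 x.2).card : ℝ) := by
      rw [hF, h]; push_cast [Nat.cast_sub (show 1 ≤ n by omega)]; rfl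
    rw [h', mul_div_cancel_left₀ _ hn1.ne']
    simp [I, N1]
  have c2 : ∀ x ∈ S, ∀ y ∈ S, ∑ p ∈ Om n, I p x * I p y ≤
      (if x = y then F / (n - 1) else 0) + F / ((n - 1) * (n - 3)) := by
    intro x hx y hy
    have hF0 : 0 ≤ F := by positivity
    have hq : 0 ≤ F / ((n - 1) * (n - 3)) := by positivity
    by_cases hxy : x = y
    · subst hxy
      have : ∀ p ∈ Om n, I p x * I p x = I p x := by
        intro p _; simp [I]
      rw [Finset.sum_congr rfl this, c1 x hx]
      simpa using hq
    · rw [if_neg hxy, zero_add]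
      have hsum : ∑ p ∈ Om n, I p x * I p y = ((N2 n x.1 x.2 y.1 y.2).card : ℝ) := by
        simp only [I, N2, N1, Finset.filter_filter]
        rw [Finset.card_filter]
        push_cast
        apply Finset.sum_congr rfl
        intro p _
        by_cases h1 : p x.1 = x.2 <;> by_cases h2 : p y.1 = y.2 <;> simp [h1, h2]
      rw [hsum]
      have hx' := hS x hx
      have hy' := hS y hy
      by_cases hd : y.1 ≠ x.1 ∧ y.1 ≠ x.2 ∧ y.2 ≠ x.1 ∧ y.2 ≠ x.2
      · obtain ⟨d1, d2, d3, d4⟩ := hd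
        have h := card_N1 hx'.ne'
        have h2 := card_N2 hx'.ne' d1 d2 d3 d4 hy'.ne'
        have h' : F = ((n - 1) * (n - 3)) * ((N2 n x.1 x.2 y.1 y.2).card : ℝ) := by
          rw [hF, h, h2]
          push_cast [Nat.cast_sub (show 1 ≤ n by omega), Nat.cast_sub (show 3 ≤ n by omega)]
          ring
        rw [h', mul_div_cancel_left₀ _ (by positivity)]
      · have : N2 n x.1 x.2 y.1 y.2 = ∅ := by
          rw [Finset.eq_empty_iff_forall_notMem]
          intro p hp
          simp only [N2, N1, Finset.mem_filter, mem_Om] at hp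
          obtain ⟨⟨⟨hi, hf⟩, e1⟩, e2⟩ := hp
          apply hd
          have e3 : p x.2 = x.1 := by rw [← e1, hi]
          have e4 : p y.2 = y.1 := by rw [← e2, hi]
          refine ⟨fun h => hxy ?_, fun h => ?_, fun h => ?_, fun h => hxy ?_⟩
          · exact Prod.ext h.symm (by rw [← e1, ← e2, h])
          · rw [h, e3] at e2; rw [h, ← e2] at hy'; exact lt_asymm hx' hy'
          · rw [h, e1] at e4; rw [h, ← e4] at hy'; exact lt_asymm hx' hy'
          · exact Prod.ext (by rw [← e3, ← e4, h]) h.symm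
        rw [this]
        simpa using hq
  have sX : ∑ p ∈ Om n, X p = M * (F / (n - 1)) := by
    simp only [X]
    rw [Finset.sum_comm, Finset.sum_congr rfl c1]
    simp [hM]
  have sX2 : ∑ p ∈ Om n, X p ^ 2 ≤ M * (F / (n - 1)) + M ^ 2 * (F / ((n - 1) * (n - 3))) := by
    have : ∑ p ∈ Om n, X p ^ 2 = ∑ x ∈ S, ∑ y ∈ S, ∑ p ∈ Om n, I p x * I p y := by
      simp only [X, sq, Finset.sum_mul_sum]
      rw [Finset.sum_comm]
      exact Finset.sum_congr rfl fun x _ => Finset.sum_comm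
    rw [this]
    refine (Finset.sum_le_sum fun x hx => Finset.sum_le_sum fun y hy => c2 x hx y hy).trans ?_
    simp only [Finset.sum_add_distrib, Finset.sum_const, Finset.sum_ite_eq, nsmul_eq_mul]
    rw [Finset.sum_congr rfl (g := fun _ => F / ((n:ℝ) - 1)) (fun x hx => if_pos hx)]
    simp only [Finset.sum_const, nsmul_eq_mul, ← hM]
    apply le_of_eq; ring
  set μ : ℝ := M / (n - 1) with hμ
  have hμ0 : 0 < μ := by positivity
  have key : (Z.card : ℝ) * μ ^ 2 ≤ ∑ p ∈ Om n, (X p - μ) ^ 2 := by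
    have : (Z.card : ℝ) * μ ^ 2 = ∑ p ∈ Z, (X p - μ) ^ 2 := by
      rw [Finset.sum_congr rfl (g := fun _ => μ ^ 2)]
      · simp
      · intro p hp
        have : X p = 0 := Finset.sum_eq_zero fun x hx => by simp [I, hZS p hp x hx]
        rw [this]; ring
    rw [this]
    exact Finset.sum_le_sum_of_subset_of_nonneg hZ fun _ _ _ => sq_nonneg _
  have exp : ∑ p ∈ Om n, (X p - μ) ^ 2 = ∑ p ∈ Om n, X p ^ 2 - 2 * μ * ∑ p ∈ Om n, X p + F * μ ^ 2 := by
    simp only [sub_sq, Finset.sum_add_distrib, Finset.sum_sub_distrib, Finset.mul_sum]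
    congr 1
    · congr 1
      exact Finset.sum_congr rfl fun _ _ => by ring
    · simp [hF]
  rw [exp, sX] at key
  have k2 : (Z.card : ℝ) * μ ^ 2 ≤ (F * (((n : ℝ) - 1) / M + 2 / ((n : ℝ) - 3))) * μ ^ 2 := by
    refine (key.trans (add_le_add (sub_le_sub_right sX2 _) le_rfl)).trans (le_of_eq ?_)
    rw [hμ]
    field_simp
    ring
  exact le_of_mul_le_mul_right k2 (by positivity)

/-- first moment for nested pairs -/
lemma nested_bound {n : ℕ} (hn : 4 ≤ n) (w : ℕ) (B : Finset (Fin n → Fin n))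
    (hB : B ⊆ Om n)
    (hBn : ∀ p ∈ B, ∃ a b c e : Fin n, a < c ∧ c < e ∧ e < b ∧ (b : ℕ) ≤ a + w ∧
      p a = b ∧ p c = e) :
    (B.card : ℝ) ≤ (Om n).card * (n * (w + 1) ^ 3 / (((n : ℝ) - 1) * (n - 3))) := by
  classical
  have hn' : (4 : ℝ) ≤ n := by exact_mod_cast hn
  have hn1 : (0 : ℝ) < n - 1 := by linarith
  have hn3 : (0 : ℝ) < n - 3 := by linarith
  set F : ℝ := ((Om n).card : ℝ) with hF
  let Q : Finset (Fin n × Fin n × Fin n × Fin n) := Finset.univ.filter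
    (fun q => q.1 < q.2.2.1 ∧ q.2.2.1 < q.2.2.2 ∧ q.2.2.2 < q.2.1 ∧ (q.2.1 : ℕ) ≤ q.1 + w)
  have hQ : Q.card ≤ n * (w + 1) ^ 3 := by
    have : ((Finset.univ : Finset (Fin n)) ×ˢ Finset.range (w+1) ×ˢ Finset.range (w+1) ×ˢ
        Finset.range (w+1)).card = n * (w + 1) ^ 3 := by
      simp only [Finset.card_product, Finset.card_univ, Fintype.card_fin, Finset.card_range]; ring
    rw [← this]
    apply Finset.card_le_card_of_injOn (fun q => (q.1, (q.2.1 : ℕ) - q.1, (q.2.2.1 : ℕ) - q.1,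
      (q.2.2.2 : ℕ) - q.1))
    · rintro ⟨a, b, c, e⟩ hq
      simp only [Q, Finset.coe_filter, Set.mem_ofPred_eq, Finset.mem_univ, true_and, Fin.lt_def] at hq
      simp only [Finset.mem_coe, Finset.mem_product, Finset.mem_univ, true_and, Finset.mem_range]
      omega
    · rintro ⟨a, b, c, e⟩ hq ⟨a', b', c', e'⟩ hq' h
      simp only [Q, Finset.coe_filter, Set.mem_ofPred_eq, Finset.mem_univ, true_and, Fin.lt_def] at hq hq'
      simp only [Prod.mk.injEq, Fin.ext_iff] at h ⊢
      omega
  have hc : ∀ q ∈ Q, ((N2 n q.1 q.2.1 q.2.2.1 q.2.2.2).card : ℝ) = F / ((n - 1) * (n - 3)) := by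
    rintro ⟨a, b, c, e⟩ hq
    simp only [Q, Finset.mem_filter, Finset.mem_univ, true_and] at hq ⊢
    obtain ⟨h1, h2, h3, -⟩ := hq
    have h := card_N1 (h1.trans (h2.trans h3)).ne'
    have h2 := card_N2 (h1.trans (h2.trans h3)).ne' h1.ne' (h2.trans h3).ne (h1.trans h2).ne' h3.ne h2.ne'
    have h' : F = ((n - 1) * (n - 3)) * ((N2 n a b c e).card : ℝ) := by
      rw [hF, h, h2]
      push_cast [Nat.cast_sub (show 1 ≤ n by omega), Nat.cast_sub (show 3 ≤ n by omega)]
      ring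
    rw [h', mul_div_cancel_left₀ _ (by positivity)]
  have hsub : B ⊆ Q.biUnion (fun q => N2 n q.1 q.2.1 q.2.2.1 q.2.2.2) := by
    intro p hp
    obtain ⟨a, b, c, e, h1, h2, h3, h4, h5, h6⟩ := hBn p hp
    rw [Finset.mem_biUnion]
    refine ⟨(a, b, c, e), by simp [Q, h1, h2, h3, h4], ?_⟩
    simp [N2, N1, h5, h6, hB hp]
  have h1 : (B.card : ℝ) ≤ ∑ q ∈ Q, ((N2 n q.1 q.2.1 q.2.2.1 q.2.2.2).card : ℝ) := by
    exact_mod_cast (Finset.card_le_card hsub).trans Finset.card_biUnion_le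
  rw [Finset.sum_congr rfl hc, Finset.sum_const, nsmul_eq_mul] at h1
  refine h1.trans ?_
  have hQ' : (Q.card : ℝ) ≤ n * (w + 1) ^ 3 := by exact_mod_cast hQ
  calc _ ≤ (n * (w + 1) ^ 3 : ℝ) * (F / ((n - 1) * (n - 3))) := by gcongr
    _ = _ := by ring

def Good (n i : ℕ) (p : Fin n → Fin n) : Prop :=
  ∃ a b : Fin n,
    i ≤ (a : ℕ) ∧ a < b ∧ p a = b ∧ Odd ((b : ℕ) - (a : ℕ)) ∧
    ∀ k : Fin n, a < k → k < b → (p k < a ∨ b < p k)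

lemma main_bound {m L k : ℕ} (hn : 4 ≤ 2 * m) (hL : L ≤ 2 * m) (hk : 0 < k) (hLk : 2 * k < L) :
    1 - ((((2 * m : ℕ) : ℝ) - 1) / (((L : ℝ) - 2 * k) * k) + 2 / (((2 * m : ℕ) : ℝ) - 3)
      + ((2 * m : ℕ) : ℝ) * (((2 * k : ℕ) : ℝ) + 1) ^ 3 /
        ((((2 * m : ℕ) : ℝ) - 1) * (((2 * m : ℕ) : ℝ) - 3)))
    ≤ matchProb (2 * m) (Good (2 * m) (2 * m - L)) := by
  classical
  have hF := Om_pos m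
  generalize 2 * m = n at *
  have hn' : (4 : ℝ) ≤ n := by exact_mod_cast hn
  have hn1 : (0 : ℝ) < n - 1 := by linarith
  have hn3 : (0 : ℝ) < n - 3 := by linarith
  let S : Finset (Fin n × Fin n) := Finset.univ.filter
    (fun x => x.1 < x.2 ∧ n - L ≤ (x.1 : ℕ) ∧ Odd ((x.2 : ℕ) - (x.1 : ℕ)) ∧ (x.2 : ℕ) ≤ x.1 + 2 * k)
  have hS : (L - 2 * k) * k ≤ S.card := by
    have : (Finset.range (L - 2 * k) ×ˢ Finset.range k).card = (L - 2 * k) * k := by simp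
    rw [← this]
    apply Finset.card_le_card_of_injOn (fun q =>
      if h : n - L + q.1 + 2 * q.2 + 1 < n then
        ((⟨n - L + q.1, by omega⟩, ⟨n - L + q.1 + 2 * q.2 + 1, h⟩) : Fin n × Fin n)
      else (⟨0, by omega⟩, ⟨0, by omega⟩))
    · rintro ⟨i, j⟩ hq
      simp only [Finset.coe_product, Set.mem_prod, Finset.mem_coe, Finset.mem_range] at hq
      have h : n - L + i + 2 * j + 1 < n := by omega
      simp only [h, dite_true, S, Finset.coe_filter, Set.mem_ofPred_eq, Finset.mem_univ, true_and,
        Fin.lt_def]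
      refine ⟨by omega, by omega, ⟨j, by omega⟩, by omega⟩
    · rintro ⟨i, j⟩ hq ⟨i', j'⟩ hq' he
      simp only [Finset.coe_product, Set.mem_prod, Finset.mem_coe, Finset.mem_range] at hq hq'
      have h : n - L + i + 2 * j + 1 < n := by omega
      have h' : n - L + i' + 2 * j' + 1 < n := by omega
      simp only [h, h', dite_true, Prod.mk.injEq, Fin.mk.injEq] at he ⊢
      omega
  have hSpos : 0 < S.card := lt_of_lt_of_le (Nat.mul_pos (by omega) hk) hS
  have hSr : ((L : ℝ) - 2 * k) * k ≤ S.card := by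
    have : (((L - 2 * k) * k : ℕ) : ℝ) ≤ S.card := by exact_mod_cast hS
    rwa [Nat.cast_mul, Nat.cast_sub hLk.le, Nat.cast_mul, Nat.cast_ofNat] at this
  have hden : 0 < ((L : ℝ) - 2 * k) * k := by
    have : (2 * k : ℝ) < L := by exact_mod_cast hLk
    have : (0 : ℝ) < k := by exact_mod_cast hk
    apply mul_pos <;> linarith
  let Z := (Om n).filter (fun p => ∀ x ∈ S, p x.1 ≠ x.2)
  let B := (Om n).filter (fun p => ∃ a b c e : Fin n, a < c ∧ c < e ∧ e < b ∧ (b : ℕ) ≤ a + 2 * k ∧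
      p a = b ∧ p c = e)
  let G := (Om n).filter (Good n (n - L))
  have bZ := second_moment hn S (fun x hx => (Finset.mem_filter.1 hx).2.1) hSpos Z
    (Finset.filter_subset _ _) (fun p hp => (Finset.mem_filter.1 hp).2)
  have bB := nested_bound hn (2 * k) B (Finset.filter_subset _ _)
    (fun p hp => (Finset.mem_filter.1 hp).2)
  have cover : Om n ⊆ G ∪ (Z ∪ B) := by
    intro p hp
    by_contra hc
    simp only [Finset.mem_union, not_or, G, Z, B, Finset.mem_filter, hp, true_and] at hc
    obtain ⟨h1, h2, h3⟩ := hc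
    push Not at h2
    obtain ⟨x, hx, hpx⟩ := h2
    simp only [S, Finset.mem_filter, Finset.mem_univ, true_and] at hx
    obtain ⟨x1, x2, x3, x4⟩ := hx
    obtain ⟨hi, hf⟩ := mem_Om.1 hp
    apply h1
    refine ⟨x.1, x.2, x2, x1, hpx, x3, fun c hac hcb => ?_⟩
    by_contra hcon
    push Not at hcon
    obtain ⟨y1, y2⟩ := hcon
    have e1 : p c ≠ x.1 := fun e => hcb.ne (by rw [← hpx, ← e, hi c])
    have e2 : p c ≠ x.2 := fun e => hac.ne' (hi.injective (e.trans hpx.symm))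
    have y1' := lt_of_le_of_ne y1 e1.symm
    have y2' := lt_of_le_of_ne y2 e2
    apply h3
    rcases lt_or_gt_of_ne (hf c) with h | h
    · exact ⟨x.1, x.2, p c, c, y1', h, hcb, x4, hpx, hi c⟩
    · exact ⟨x.1, x.2, c, p c, hac, h, y2', x4, hpx, rfl⟩
  have hcard : ((Om n).card : ℝ) ≤ G.card + (Z.card + B.card) := by
    exact_mod_cast (Finset.card_le_card cover).trans
      ((Finset.card_union_le _ _).trans (Nat.add_le_add_left (Finset.card_union_le _ _) _))
  have hmp : matchProb n (Good n (n - L)) = (G.card : ℝ) / (Om n).card := by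
    unfold matchProb
    congr 2
    · rw [Nat.card_eq_fintype_card, Fintype.card_subtype]
      congr 1; ext p; simp [G, mem_Om, and_assoc]
    · rw [Nat.card_eq_fintype_card, Fintype.card_subtype]
      rfl
  have hFr : (0 : ℝ) < (Om n).card := by exact_mod_cast hF
  rw [hmp, le_div_iff₀ hFr]
  have bZ' : (Z.card : ℝ) ≤ (Om n).card * (((n : ℝ) - 1) / (((L : ℝ) - 2 * k) * k) + 2 / ((n : ℝ) - 3)) := by
    refine bZ.trans ?_
    gcongr
  nlinarith

lemma matchProb_le_one (n : ℕ) (A) : matchProb n A ≤ 1 := by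
  unfold matchProb
  apply div_le_one_of_le₀ _ (by positivity)
  norm_cast
  exact Nat.card_le_card_of_injective (fun p => ⟨p.1, p.2.1, p.2.2.1⟩)
    (fun p q h => Subtype.ext (by simpa using h))

noncomputable def LL (x : ℝ) : ℕ := ⌊x / Real.log (Real.log x)⌋₊
noncomputable def KK (x : ℝ) : ℕ := ⌊Real.log x⌋₊

noncomputable def err (x : ℝ) : ℝ :=
  (x - 1) / (((LL x : ℝ) - 2 * KK x) * KK x) + 2 / (x - 3)
      + x * (2 * (KK x : ℝ) + 1) ^ 3 / ((x - 1) * (x - 3))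

open Filter Topology

/-- (L-2k)k/x → ∞ -/
lemma ratio_tendsto : Tendsto (fun x : ℝ => (((LL x : ℝ) - 2 * KK x) * KK x) / x) atTop atTop := by
  have hl := Real.tendsto_log_atTop
  have hll := hl.comp hl
  have h1 : Tendsto (fun y : ℝ => y / Real.log y) atTop atTop := by
    have := (Real.isLittleO_log_id_atTop).tendsto_div_nhds_zero
    have h2 : Tendsto (fun y : ℝ => Real.log y / y) atTop (𝓝[>] 0) := by
      rw [tendsto_nhdsWithin_iff]
      refine ⟨this, ?_⟩
      filter_upwards [eventually_gt_atTop 1] with y hy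
      exact div_pos (Real.log_pos hy) (by linarith)
    refine h2.inv_tendsto_nhdsGT_zero.congr fun y => ?_
    simp
  have h2 := h1.comp hl
  have hsq : ∀ᶠ x : ℝ in atTop, Real.log x ^ 2 ≤ x := by
    filter_upwards [(Real.isLittleO_pow_log_id_atTop (n := 2)).bound one_pos, eventually_gt_atTop 0]
      with x hx h0
    simpa [abs_of_pos h0] using hx
  refine tendsto_atTop_mono' _ ?_ (tendsto_atTop_add_const_right _ (-4) h2)
  filter_upwards [hsq, hl.eventually_ge_atTop 1, hll.eventually_ge_atTop 1, eventually_ge_atTop 1]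
    with x hx hlx hllx hx1
  simp only [Function.comp] at *
  have a1 : x / Real.log (Real.log x) - 1 ≤ LL x := (Nat.sub_one_lt_floor _).le
  have a2 : Real.log x - 1 ≤ KK x := (Nat.sub_one_lt_floor _).le
  have a3 : (KK x : ℝ) ≤ Real.log x := Nat.floor_le (by linarith)
  have a0 : (0 : ℝ) ≤ KK x := by positivity
  set l := Real.log x
  set u := Real.log l
  set k : ℝ := (KK x : ℝ)
  set L : ℝ := (LL x : ℝ)
  rw [le_div_iff₀ (by linarith)]
  have e : (l / u + -4) * x = (x / u) * l - 4 * x := by ring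
  rw [e]
  have hxu : x / u ≤ x := div_le_self (by linarith) hllx
  have hxu0 : 0 ≤ x / u := by positivity
  have s1 : (x / u - 1) * k ≤ L * k := mul_le_mul_of_nonneg_right a1 a0
  have s2 : (x / u) * (l - 1) ≤ (x / u) * k := mul_le_mul_of_nonneg_left a2 hxu0
  have s3 : k * k ≤ l ^ 2 := by rw [sq]; exact mul_le_mul a3 a3 a0 (by linarith)
  have s4 : k ≤ l ^ 2 := by nlinarith
  nlinarith

lemma asymp_ev : ∀ᶠ x : ℝ in atTop, 4 ≤ x ∧ (LL x : ℝ) ≤ x ∧ 0 < KK x ∧ 2 * (KK x : ℝ) < LL x := by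
  have hl := Real.tendsto_log_atTop
  have hll := hl.comp hl
  filter_upwards [eventually_ge_atTop 4, hl.eventually_ge_atTop 1, hll.eventually_ge_atTop 1,
    ratio_tendsto.eventually_gt_atTop 0] with x h4 hlx hllx hr
  have hk : 0 < KK x := Nat.floor_pos.2 hlx
  refine ⟨h4, ?_, hk, ?_⟩
  · simp only [Function.comp] at hllx
    exact (Nat.floor_le (by positivity)).trans (div_le_self (by linarith) hllx)
  · have hk' : (0 : ℝ) < KK x := by exact_mod_cast hk
    have := (div_pos_iff_of_pos_right (by linarith : (0:ℝ) < x)).1 hr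
    have := (mul_pos_iff_of_pos_right hk').1 this
    linarith

lemma asymp : Tendsto err atTop (𝓝 0) := by
  have hl := Real.tendsto_log_atTop
  have b1 : Tendsto (fun x : ℝ => ((((LL x : ℝ) - 2 * KK x) * KK x) / x)⁻¹) atTop (𝓝 0) :=
    ratio_tendsto.inv_tendsto_atTop
  have b2 : Tendsto (fun x : ℝ => 2 / (x - 3)) atTop (𝓝 0) :=
    (tendsto_atTop_add_const_right _ (-3) tendsto_id).const_div_atTop 2
  have b3 : Tendsto (fun x : ℝ => 432 * (Real.log x ^ 3 / x)) atTop (𝓝 0) := by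
    have := (Real.isLittleO_pow_log_id_atTop (n := 3)).tendsto_div_nhds_zero
    simpa using this.const_mul 432
  have b := (b1.add b2).add b3
  simp only [add_zero] at b
  refine tendsto_of_tendsto_of_tendsto_of_le_of_le' tendsto_const_nhds b ?_ ?_
  · filter_upwards [asymp_ev] with x hx
    obtain ⟨h4, hL, hk, hLk⟩ := hx
    have : 0 < (LL x : ℝ) - 2 * KK x := by linarith
    have : 0 < x - 1 := by linarith
    have : 0 < x - 3 := by linarith
    unfold err
    positivity
  · filter_upwards [asymp_ev, hl.eventually_ge_atTop 1] with x hx hlx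
    obtain ⟨h4, hL, hk, hLk⟩ := hx
    have p0 : 0 < (LL x : ℝ) - 2 * KK x := by linarith
    have p1 : 0 < x - 1 := by linarith
    have p3 : 0 < x - 3 := by linarith
    have a3 : (KK x : ℝ) ≤ Real.log x := Nat.floor_le (by linarith)
    unfold err
    gcongr ?_ + _ + ?_
    · rw [inv_div]
      gcongr
      linarith
    · have q1 : (2 * (KK x : ℝ) + 1) ^ 3 ≤ (3 * Real.log x) ^ 3 := by
        gcongr; linarith
      have q2 : x ^ 2 ≤ 16 * ((x - 1) * (x - 3)) := by nlinarith
      have hl3 : 0 ≤ Real.log x ^ 3 := by positivity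
      have hx0 : 0 < x := by linarith
      calc x * (2 * (KK x : ℝ) + 1) ^ 3 / ((x - 1) * (x - 3))
          ≤ x * (3 * Real.log x) ^ 3 / (x ^ 2 / 16) := by
            gcongr; linarith
        _ = 432 * (Real.log x ^ 3 / x) := by field_simp; ring

theorem stmt8 :
    Filter.Tendsto (fun m : ℕ =>
      matchProb (2 * m) (fun p =>
        ∃ a b : Fin (2 * m),
          endPhase (2 * m) ≤ (a : ℕ) ∧ a < b ∧ p a = b ∧ Odd ((b : ℕ) - (a : ℕ)) ∧
          ∀ k : Fin (2 * m), a < k → k < b → (p k < a ∨ b < p k)))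
      Filter.atTop (nhds 1) := by
  have h2 : Filter.Tendsto (fun m : ℕ => ((2 * m : ℕ) : ℝ)) Filter.atTop Filter.atTop :=
    tendsto_natCast_atTop_atTop.comp
      (Filter.tendsto_id.const_mul_atTop' (by norm_num : 0 < 2))
  have hlow := (tendsto_const_nhds (x := (1:ℝ))).sub (asymp.comp h2)
  rw [sub_zero] at hlow
  refine tendsto_of_tendsto_of_tendsto_of_le_of_le' hlow tendsto_const_nhds ?_
    (Filter.Eventually.of_forall fun m => matchProb_le_one _ _)
  filter_upwards [h2.eventually asymp_ev] with m hm
  obtain ⟨h4, hL, hk, hLk⟩ := hm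
  refine le_trans (le_of_eq ?_) (main_bound (m := m) (L := LL ((2 * m : ℕ) : ℝ))
    (k := KK ((2 * m : ℕ) : ℝ)) (by exact_mod_cast h4) (by exact_mod_cast hL) hk (by exact_mod_cast hLk))
  simp [err]
end

section
/- For every finite simple graph G with at least one vertex, s(G) ≤ (χ(G) − 1)·α(G), where χ(G) is the chromatic number of G and α(G) is the independence number of G (the maximum size of an independent set of vertices). -/
/-- `S` is a Sudoku set for `G`: there is some partial colouring of `S` with `χ(G)`
colours which extends to exactly one proper `χ(G)`-colouring of all of `G`. -/
def IsSudokuSet {V : Type*} (G : SimpleGraph V) (S : Finset V) : Prop :=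
  ∃ c₀ : V → Fin G.chromaticNumber.toNat,
    ∃! c : G.Coloring (Fin G.chromaticNumber.toNat), ∀ v ∈ S, c v = c₀ v

/-- The Sudoku number of `G`: the smallest possible size of a Sudoku set. -/
noncomputable def sudokuNumber {V : Type*} (G : SimpleGraph V) : ℕ :=
  sInf {k | ∃ S : Finset V, IsSudokuSet G S ∧ S.card = k}

/-- The independence number of `G`: the maximum size of an independent set. -/
noncomputable def indepNum {V : Type*} (G : SimpleGraph V) : ℕ :=
  sSup {k | ∃ s : Finset V, (∀ v ∈ s, ∀ w ∈ s, v ≠ w → ¬G.Adj v w) ∧ s.card = k}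

/-- For every finite simple graph `G` with at least one vertex,
`s(G) ≤ (χ(G) − 1)·α(G)`. -/
theorem stmt16 {V : Type*} [Fintype V] [Nonempty V] (G : SimpleGraph V) :
    sudokuNumber G ≤ (G.chromaticNumber.toNat - 1) * indepNum G := by
  classical
  have hcol : G.Colorable G.chromaticNumber.toNat := by
    have h := G.colorable_of_fintype
    exact SimpleGraph.colorable_chromaticNumber h
  obtain ⟨c1⟩ := hcol
  obtain ⟨v0⟩ := (inferInstance : Nonempty V)
  unfold sudokuNumber IsSudokuSet
  generalize G.chromaticNumber.toNat = k at *
  let z : Fin k := c1 v0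
  let f : G.Coloring (Fin k) → ℕ := fun c => (Finset.univ.filter (fun v => c v = z)).card
  obtain ⟨c, hc⟩ : ∃ c, ∀ c', f c ≤ f c' := by
    have : Nonempty (G.Coloring (Fin k)) := ⟨c1⟩
    exact ⟨Function.argmin f, fun c' => Function.argmin_le f c'⟩
  have key : ∀ v, c v = z → ∀ j, j ≠ z → ∃ w, G.Adj v w ∧ c w = j := by
    intro v hv j hj
    by_contra! hno
    let c' : G.Coloring (Fin k) := SimpleGraph.Coloring.mk (Function.update c v j) (by
      intro a b hab
      have hne := hab.ne
      by_cases ha : a = v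
      · subst ha
        rw [Function.update_self, Function.update_of_ne hne.symm]
        exact (hno b hab).symm
      · by_cases hb : b = v
        · subst hb
          rw [Function.update_self, Function.update_of_ne ha]
          exact hno a hab.symm
        · rw [Function.update_of_ne ha, Function.update_of_ne hb]
          exact c.valid hab)
    have hc'v : ∀ w, c' w = Function.update c v j w := fun w => rfl
    have : f c' < f c := by
      apply Finset.card_lt_card
      rw [Finset.ssubset_iff_of_subset]
      · refine ⟨v, by simpa using hv, ?_⟩
        simp [hc'v, hj]
      · intro w hw
        simp only [Finset.mem_filter, Finset.mem_univ, true_and, hc'v] at hw ⊢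
        by_cases h : w = v
        · rw [h]; exact hv
        · rwa [Function.update_of_ne h] at hw
    exact absurd (hc c') (by omega)
  let S : Finset V := Finset.univ.filter (fun v => c v ≠ z)
  refine le_trans (Nat.sInf_le (m := S.card) ⟨S, ⟨c, c, fun v _ => rfl, ?_⟩, rfl⟩) ?_
  · intro c' hc'
    apply DFunLike.ext
    intro v
    by_cases hv : c v = z
    · rw [hv]
      by_contra hne
      obtain ⟨w, hw, hcw⟩ := key v hv _ hne
      have h1 : c' w = c w := hc' w (by simp [S, hcw, hne])
      exact c'.valid hw (by rw [h1, hcw])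
    · exact hc' v (by simp [S, hv])
  · have hS : S.card ≤ indepNum G * (Finset.univ.erase z).card := by
      apply Finset.card_le_mul_card_image_of_maps_to (f := c)
      · intro v hv
        simpa [S] using hv
      · intro j _
        apply le_csSup
        · refine ⟨Fintype.card V, ?_⟩
          rintro n ⟨s, -, rfl⟩
          exact s.card_le_univ
        · refine ⟨_, ?_, rfl⟩
          intro a ha b hb _ hab
          simp only [Finset.mem_filter] at ha hb
          exact c.valid hab (ha.2.trans hb.2.symm)
    rw [Finset.card_erase_of_mem (Finset.mem_univ _), Finset.card_fin, mul_comm] at hS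
    exact hS
end

section
/- Let d ≥ 2, let G be a finite simple d-regular graph with χ(G) = d, and let S be a strong Sudoku set for G. Then the induced subgraph of G on V(G) \ S contains no cycle (it is a forest). -/
/-- Let `G` be a finite simple `d`-regular graph (`d ≥ 2`) with `χ(G) = d`, let `S`
be a Sudoku set witnessed by a partial colouring `c₀` on `S` with unique proper
`d`-colouring extension `c`, and suppose `S` is strong: there is an ordering
(a duplicate-free list `l`) of `V(G) \ S` such that each `l.get i` has, for every
colour `k ≠ c (l.get i)`, a neighbour of colour `k` in `S ∪ {l.get j : j < i}`.
Then the induced subgraph of `G` on `V(G) \ S` contains no cycle. -/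
theorem stmt17 {V : Type*} [Fintype V] [DecidableEq V] (G : SimpleGraph V)
    (d : ℕ) (hd : 2 ≤ d)
    (hreg : ∀ v, Nat.card (G.neighborSet v) = d)
    (hchi : G.chromaticNumber = d)
    (S : Finset V) (c₀ : V → Fin d) (c : G.Coloring (Fin d))
    (hext : ∀ v ∈ S, c v = c₀ v)
    (huniq : ∀ c' : G.Coloring (Fin d), (∀ v ∈ S, c' v = c₀ v) → c' = c)
    (l : List V) (hnd : l.Nodup) (hmem : ∀ v, v ∈ l ↔ v ∉ S)
    (hstrong : ∀ (i : ℕ) (hi : i < l.length) (k : Fin d), k ≠ c (l.get ⟨i, hi⟩) →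
      ∃ w, G.Adj (l.get ⟨i, hi⟩) w ∧ c w = k ∧ (w ∈ S ∨ w ∈ l.take i)) :
    (G.induce ((S : Set V)ᶜ)).IsAcyclic := by
  classical
  intro a p hp
  obtain ⟨u, hu, hmin⟩ := Finset.exists_min_image p.support.toFinset
    (fun v => l.idxOf (v : V)) ⟨a, by simp⟩
  have hu' : u ∈ p.support := by simpa using hu
  have hq := hp.rotate hu'
  set q := p.rotate u hu' with hqdef
  have hsup : ∀ v ∈ q.support, l.idxOf (u : V) ≤ l.idxOf (v : V) := by
    intro v hv
    apply hmin
    simpa [hqdef] using hv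
  have hne := hq.snd_ne_penultimate
  have hx := q.adj_snd hq.not_nil
  have hy := q.adj_penultimate hq.not_nil
  have hxs := hsup _ (q.getVert_mem_support 1)
  have hys := hsup _ (q.getVert_mem_support (q.length - 1))
  change l.idxOf (u : V) ≤ l.idxOf (q.snd : V) at hxs
  change l.idxOf (u : V) ≤ l.idxOf (q.penultimate : V) at hys
  generalize q.snd = x at *
  generalize q.penultimate = y at *
  have hul : (u : V) ∈ l := (hmem _).2 (fun h => u.2 (Finset.mem_coe.2 h))
  have hi := List.idxOf_lt_length_of_mem hul
  have hget : l.get ⟨l.idxOf (u : V), hi⟩ = u := by simp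
  have hs := hstrong _ hi
  rw [hget] at hs
  haveI : Nonempty V := ⟨u⟩
  choose! f hf1 hf2 hf3 using hs
  have key : ∀ z : ((S : Set V)ᶜ : Set V), l.idxOf (u : V) ≤ l.idxOf (z : V) →
      (z : V) ∉ (Finset.univ.erase (c u)).image f := by
    intro z hz h
    obtain ⟨k, hk, hkz⟩ := Finset.mem_image.1 h
    have h3 := hf3 k (Finset.ne_of_mem_erase hk)
    rw [hkz] at h3
    have hzS : (z : V) ∉ S := fun h => z.2 (Finset.mem_coe.2 h)
    rcases h3 with h3 | h3
    · exact hzS h3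
    · have := (List.mem_take_iff_idxOf_lt ((hmem _).2 hzS)).1 h3
      omega
  have hcard : ((Finset.univ.erase (c u)).image f).card = d - 1 := by
    rw [Finset.card_image_of_injOn]
    · simp
    · intro k hk k' hk' h
      rw [← hf2 k (by simpa using hk), ← hf2 k' (by simpa using hk'), h]
  have hsub : insert (x : V) (insert (y : V) ((Finset.univ.erase (c u)).image f))
      ⊆ G.neighborFinset u := by
    intro w hw
    rw [SimpleGraph.mem_neighborFinset]
    rcases Finset.mem_insert.1 hw with rfl | hw
    · exact hx
    rcases Finset.mem_insert.1 hw with rfl | hw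
    · exact hy.symm
    obtain ⟨k, hk, rfl⟩ := Finset.mem_image.1 hw
    exact hf1 k (Finset.ne_of_mem_erase hk)
  have hle := Finset.card_le_card hsub
  have hd' : (G.neighborFinset u).card = d := by
    rw [← hreg u, Nat.card_eq_fintype_card, SimpleGraph.card_neighborSet_eq_degree,
      SimpleGraph.card_neighborFinset_eq_degree]
  rw [Finset.card_insert_of_notMem, Finset.card_insert_of_notMem (key y hys), hcard, hd'] at hle
  · omega
  · rw [Finset.mem_insert]
    rintro (h | h)
    · exact hne (Subtype.ext h)
    · exact key x hxs h
end
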